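/- No 3-quasi-Sasakian manifold is η-Einstein except in the following cases: (i) 3-α-Sasakian manifolds, which are Einstein with strictly positive scalar curvature; (ii) 3-cosymplectic manifolds, which are Ricci-flat; (iii) 3-quasi-Sasakian manifolds of rank 3, which are η-Einstein but not Einstein. -/

import Mathlib

/-!
An abstract (Lie–Rinehart style) algebraic model of the differential geometry of
almost contact metric 3-structures: `F` plays the role of the algebra of smooth
functions on a manifold `M` of dimension `4n+3`, and `V` plays the role of the
`F`-module of smooth vector fields, acting on `F` by derivations and carrying a
Lie bracket, a Riemannian metric `g`, and three almost contact metric structures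
`(φ_α, ξ_α, η_α, g)`.
-/

noncomputable section

namespace QS3

/-- Cyclic (= even) permutations of `{0,1,2}`, modelling even permutations of `{1,2,3}`. -/
def Cyclic (a b c : Fin 3) : Prop :=
  (a, b, c) = (0, 1, 2) ∨ (a, b, c) = (1, 2, 0) ∨ (a, b, c) = (2, 0, 1)

/-- The algebraic model of the smooth structure of a manifold: an `ℝ`-algebra `F`
of smooth functions and an `F`-module `V` of vector fields acting on `F` by
derivations and carrying the Lie bracket of vector fields. -/
class SmoothSetting (F : Type) (V : Type) [CommRing F] [Algebra ℝ F]
    [AddCommGroup V] [Module F V] where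
  act : V → F → F
  bracket : V → V → V
  act_add : ∀ (X : V) (f₁ f₂ : F), act X (f₁ + f₂) = act X f₁ + act X f₂
  act_mul : ∀ (X : V) (f₁ f₂ : F), act X (f₁ * f₂) = act X f₁ * f₂ + f₁ * act X f₂
  act_const : ∀ (X : V) (r : ℝ), act X (algebraMap ℝ F r) = 0
  act_addLeft : ∀ (X Y : V) (f : F), act (X + Y) f = act X f + act Y f
  act_smulLeft : ∀ (f : F) (X : V) (h : F), act (f • X) h = f * act X h
  bracket_antisymm : ∀ X Y : V, bracket X Y = -bracket Y X
  bracket_addLeft : ∀ X Y Z : V, bracket (X + Y) Z = bracket X Z + bracket Y Z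
  bracket_act : ∀ (X Y : V) (f : F),
    act (bracket X Y) f = act X (act Y f) - act Y (act X f)
  bracket_smulRight : ∀ (X : V) (f : F) (Y : V),
    bracket X (f • Y) = f • bracket X Y + act X f • Y
  jacobi : ∀ X Y Z : V,
    bracket X (bracket Y Z) + bracket Y (bracket Z X) + bracket Z (bracket X Y) = 0

section d

variable (F V : Type) [CommRing F] [Algebra ℝ F] [AddCommGroup V] [Module F V]
  [SmoothSetting F V]

/-- The action of a vector field on a function (directional derivative). -/
def der (X : V) (f : F) : F := SmoothSetting.act X f

/-- The Lie bracket of vector fields. -/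
def lie (X Y : V) : V := SmoothSetting.bracket F X Y

/-- Exterior differential of a 1-form (with the `1/2` normalization convention,
so that `2 dθ(X,Y) = X θ(Y) - Y θ(X) - θ([X,Y])`). -/
def dOne (θ : V → F) (X Y : V) : F :=
  (2 : ℝ)⁻¹ • (der F V X (θ Y) - der F V Y (θ X) - θ (lie F V X Y))

/-- Exterior differential of a 2-form (with the `1/3` normalization convention). -/
def dTwo (ω : V → V → F) (X Y Z : V) : F :=
  (3 : ℝ)⁻¹ • (der F V X (ω Y Z) + der F V Y (ω Z X) + der F V Z (ω X Y)
    - ω (lie F V X Y) Z - ω (lie F V Y Z) X - ω (lie F V Z X) Y)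

end d

/-- An almost contact metric 3-structure on a manifold of dimension `4n+3`:
three almost contact metric structures `(φ_α, ξ_α, η_α, g)` satisfying the
quaternionic-type relations, together with a (local) orthonormal frame. -/
class ACM3 (F V : Type) [CommRing F] [Algebra ℝ F] [AddCommGroup V] [Module F V]
    [SmoothSetting F V] where
  n : ℕ
  g : V → V → F
  phi : Fin 3 → V → V
  xi : Fin 3 → V
  eta : Fin 3 → V → F
  g_symm : ∀ X Y, g X Y = g Y X
  g_addLeft : ∀ X Y Z, g (X + Y) Z = g X Z + g Y Z
  g_smulLeft : ∀ (f : F) (X Y : V), g (f • X) Y = f * g X Y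
  g_nondeg : ∀ X, (∀ Y, g X Y = 0) → X = 0
  phi_add : ∀ α (X Y : V), phi α (X + Y) = phi α X + phi α Y
  phi_smul : ∀ α (f : F) (X : V), phi α (f • X) = f • phi α X
  eta_eq : ∀ α X, eta α X = g X (xi α)
  acm_sq : ∀ α X, phi α (phi α X) = -X + eta α X • xi α
  eta_xi : ∀ α, eta α (xi α) = 1
  compat : ∀ α X Y, g (phi α X) (phi α Y) = g X Y - eta α X * eta α Y
  quat_phi : ∀ a b c, Cyclic a b c → ∀ X, phi c X = phi a (phi b X) - eta b X • xi a
  quat_phi' : ∀ a b c, Cyclic a b c → ∀ X, phi c X = -(phi b (phi a X)) + eta a X • xi b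
  quat_xi : ∀ a b c, Cyclic a b c → xi c = phi a (xi b)
  quat_xi' : ∀ a b c, Cyclic a b c → xi c = -(phi b (xi a))
  quat_eta : ∀ a b c, Cyclic a b c → ∀ X, eta c X = eta a (phi b X)
  quat_eta' : ∀ a b c, Cyclic a b c → ∀ X, eta c X = -(eta b (phi a X))
  frame : Fin (4 * n + 3) → V
  frame_orth : ∀ i j, g (frame i) (frame j) = if i = j then 1 else 0
  frame_span : ∀ X : V, X = ∑ i, g X (frame i) • frame i

section acm

variable (F V : Type) [CommRing F] [Algebra ℝ F] [AddCommGroup V] [Module F V]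
  [SmoothSetting F V] [ACM3 F V]

/-- The integer `n` (the manifold has dimension `4n+3`). -/
def dimn : ℕ := ACM3.n F V

/-- The Riemannian metric. -/
def gm (X Y : V) : F := ACM3.g X Y

/-- The structure tensors `φ_α`. -/
def ph (α : Fin 3) (X : V) : V := ACM3.phi F α X

/-- The Reeb vector fields `ξ_α`. -/
def rxi (α : Fin 3) : V := ACM3.xi F α

/-- The 1-forms `η_α`. -/
def et (α : Fin 3) (X : V) : F := ACM3.eta α X

/-- The orthonormal frame. -/
def fr (i : Fin (4 * dimn F V + 3)) : V := ACM3.frame i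

/-- The fundamental 2-form `Φ_α(X,Y) = g(X, φ_α Y)`. -/
def Phi (α : Fin 3) (X Y : V) : F := gm F V X (ph F V α Y)

/-- The Nijenhuis torsion `[φ_α, φ_α]` of `φ_α`. -/
def Nij (α : Fin 3) (X Y : V) : V :=
  ph F V α (ph F V α (lie F V X Y)) + lie F V (ph F V α X) (ph F V α Y)
    - ph F V α (lie F V (ph F V α X) Y) - ph F V α (lie F V X (ph F V α Y))

/-- The normality tensor `N⁽¹⁾_α = [φ_α, φ_α] + 2 dη_α ⊗ ξ_α`. -/
def NOne (α : Fin 3) (X Y : V) : V :=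
  Nij F V α X Y + ((2 : ℝ) • dOne F V (et F V α) X Y) • rxi F V α

/-- The structure `(φ_α, ξ_α, η_α)` is normal. -/
def IsNormal (α : Fin 3) : Prop := ∀ X Y, NOne F V α X Y = 0

/-- A 2-form is closed. -/
def IsClosedTwo (ω : V → V → F) : Prop := ∀ X Y Z, dTwo F V ω X Y Z = 0

/-- The structure `(φ_α, ξ_α, η_α, g)` is quasi-Sasakian: normal with closed
fundamental 2-form. -/
def IsQuasiSasakian (α : Fin 3) : Prop :=
  IsNormal F V α ∧ IsClosedTwo F V (Phi F V α)

/-- `M` is 3-cosymplectic: each structure is normal with `dη_α = 0` and `dΦ_α = 0`. -/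
def ThreeCosymplectic : Prop :=
  ∀ α, IsNormal F V α ∧ (∀ X Y, dOne F V (et F V α) X Y = 0) ∧
    IsClosedTwo F V (Phi F V α)

/-- `M` is 3-α-Sasakian with constant `a ≠ 0`: each structure is normal (an
`α`-Sasakian structure) and `dη_δ = a Φ_δ`. -/
def Is3AlphaSasakianWith (a : ℝ) : Prop :=
  a ≠ 0 ∧ (∀ δ, IsNormal F V δ) ∧
    ∀ (δ : Fin 3) (X Y : V), dOne F V (et F V δ) X Y = algebraMap ℝ F a * Phi F V δ X Y

/-- A vector field is horizontal: it lies in `H = ∩_α ker η_α`. -/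
def Horiz (X : V) : Prop := ∀ α, et F V α X = 0

/-- A vector field is vertical: it lies in `V = ⟨ξ₁, ξ₂, ξ₃⟩`. -/
def InVert (X : V) : Prop :=
  ∃ p q r : F, X = p • rxi F V 0 + q • rxi F V 1 + r • rxi F V 2

/-- The distribution `E^{4m} = {X ∈ H : i_X dη_α = 0}`. -/
def InE4m (X : V) : Prop :=
  Horiz F V X ∧ ∀ (α : Fin 3) (Y : V), dOne F V (et F V α) X Y = 0

/-- The distribution `E^{4l}`: the orthogonal complement of `E^{4m}` in `H`. -/
def InE4l (X : V) : Prop :=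
  Horiz F V X ∧ ∀ Y, InE4m F V Y → gm F V X Y = 0

/-- The distribution `E^{4l+3} = E^{4l} ⊕ V`. -/
def InE4l3 (X : V) : Prop :=
  ∃ Y Z, InE4l F V Y ∧ InVert F V Z ∧ X = Y + Z

/-- The distribution `E^{4m+3} = E^{4m} ⊕ V`. -/
def InE4m3 (X : V) : Prop :=
  ∃ Y Z, InE4m F V Y ∧ InVert F V Z ∧ X = Y + Z

/-- The horizontal component `X_H = X - ∑_α η_α(X) ξ_α` of a vector field. -/
def horComp (X : V) : V := X - ∑ α : Fin 3, et F V α X • rxi F V α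

/-- A vector field is basic with respect to the foliation defined by `E^{4m}`. -/
def BasicE4m (X : V) : Prop :=
  InE4l3 F V X ∧ ∀ W, InE4m F V W → InE4m F V (lie F V W X)

/-- A vector field is basic with respect to the foliation defined by `E^{4l+3}`. -/
def BasicE4l3 (X : V) : Prop :=
  InE4m F V X ∧ ∀ W, InE4l3 F V W → InE4l3 F V (lie F V W X)

end acm

/-- A 3-quasi-Sasakian structure: each of the three almost contact metric
structures is quasi-Sasakian.  We also record, as part of the structure, the
standard structural facts established for such manifolds in the literature
(Cappelletti Montano–De Nicola–Dileo): the Reeb commutation relations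
`[ξ_α, ξ_β] = c ξ_γ`, the splitting `H = E^{4l} ⊕ E^{4m}` (constancy of the
rank), the `φ_α`-invariance of both distributions, and the tensors `ψ_α`
(equal to `φ_α` on `E^{4l+3}` and vanishing on `E^{4m}` when the rank is
`4l+3`, i.e. `c ≠ 0`; equal to `φ_α` on `E^{4l}` and vanishing on `E^{4m+3}`
when the rank is `4l+1`, i.e. `c = 0`). -/
class ThreeQS (F V : Type) [CommRing F] [Algebra ℝ F] [AddCommGroup V] [Module F V]
    [SmoothSetting F V] [ACM3 F V] where
  qs : ∀ α, IsQuasiSasakian F V α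
  c : ℝ
  reeb_bracket : ∀ a b c', Cyclic a b c' →
    lie F V (rxi F V a) (rxi F V b) = algebraMap ℝ F c • rxi F V c'
  horiz_split : ∀ X, Horiz F V X → ∃ Y Z, InE4l F V Y ∧ InE4m F V Z ∧ X = Y + Z
  phi_E4l : ∀ α X, InE4l F V X → InE4l F V (ph F V α X)
  phi_E4m : ∀ α X, InE4m F V X → InE4m F V (ph F V α X)
  psi : Fin 3 → V → V
  psi_add : ∀ α (X Y : V), psi α (X + Y) = psi α X + psi α Y
  psi_smul : ∀ α (f : F) (X : V), psi α (f • X) = f • psi α X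
  psi_E4l : ∀ α X, InE4l F V X → psi α X = ph F V α X
  psi_E4m : ∀ α X, InE4m F V X → psi α X = 0
  psi_vert_of_ne : c ≠ 0 → ∀ α β, psi α (rxi F V β) = ph F V α (rxi F V β)
  psi_vert_of_eq : c = 0 → ∀ α β, psi α (rxi F V β) = 0

section tqs

variable (F V : Type) [CommRing F] [Algebra ℝ F] [AddCommGroup V] [Module F V]
  [SmoothSetting F V] [ACM3 F V] [ThreeQS F V]

/-- The constant `c` with `[ξ_α, ξ_β] = c ξ_γ`. -/
def cc : ℝ := ThreeQS.c F V

/-- The tensors `ψ_α`. -/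
def psiT (α : Fin 3) (X : V) : V := ThreeQS.psi F α X

/-- The tensors `θ_α = φ_α - ψ_α`. -/
def thetaT (α : Fin 3) (X : V) : V := ph F V α X - psiT F V α X

/-- The 2-forms `Θ_α(X,Y) = g(X, θ_α Y)`. -/
def ThetaForm (α : Fin 3) (X Y : V) : F := gm F V X (thetaT F V α Y)

end tqs

/-- The 3-quasi-Sasakian manifold has rank `4l+3`: the constant `c` is nonzero
and the orthonormal frame is adapted to the splitting
`TM = E^{4l} ⊕ E^{4m} ⊕ ⟨ξ₁,ξ₂,ξ₃⟩` with `dim E^{4l} = 4l` (hence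
`dim E^{4m} = 4m`, `m = n - l`, and the rank of the `η_α` is `4l+3`). -/
class HasRank (F V : Type) [CommRing F] [Algebra ℝ F] [AddCommGroup V] [Module F V]
    [SmoothSetting F V] [ACM3 F V] [ThreeQS F V] (l : ℕ) : Prop where
  c_ne : cc F V ≠ 0
  l_le : l ≤ dimn F V
  frame_E4l : ∀ i : Fin (4 * dimn F V + 3), i.val < 4 * l → InE4l F V (fr F V i)
  frame_E4m : ∀ i : Fin (4 * dimn F V + 3), 4 * l ≤ i.val → i.val < 4 * dimn F V →
    InE4m F V (fr F V i)
  frame_xi : ∀ (i : Fin (4 * dimn F V + 3)) (a : Fin 3),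
    i.val = 4 * dimn F V + a.val → fr F V i = rxi F V a

/-- The Levi-Civita connection of `g`: the unique torsion-free metric connection. -/
class LeviCivita (F V : Type) [CommRing F] [Algebra ℝ F] [AddCommGroup V] [Module F V]
    [SmoothSetting F V] [ACM3 F V] where
  nabla : V → V → V
  nabla_addLeft : ∀ X Y Z : V, nabla (X + Y) Z = nabla X Z + nabla Y Z
  nabla_smulLeft : ∀ (f : F) (X Y : V), nabla (f • X) Y = f • nabla X Y
  nabla_addRight : ∀ X Y Z : V, nabla X (Y + Z) = nabla X Y + nabla X Z
  nabla_leibniz : ∀ (X : V) (f : F) (Y : V),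
    nabla X (f • Y) = der F V X f • Y + f • nabla X Y
  nabla_metric : ∀ X Y Z : V,
    der F V X (gm F V Y Z) = gm F V (nabla X Y) Z + gm F V Y (nabla X Z)
  nabla_torsionFree : ∀ X Y : V, nabla X Y - nabla Y X = lie F V X Y

section curv

variable (F V : Type) [CommRing F] [Algebra ℝ F] [AddCommGroup V] [Module F V]
  [SmoothSetting F V] [ACM3 F V] [LeviCivita F V]

/-- The Levi-Civita covariant derivative `∇_X Y`. -/
def nab (X Y : V) : V := LeviCivita.nabla F X Y

/-- The Riemannian curvature `R(X,Y)Z = ∇_X ∇_Y Z - ∇_Y ∇_X Z - ∇_{[X,Y]} Z`. -/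
def Rcurv (X Y Z : V) : V :=
  nab F V X (nab F V Y Z) - nab F V Y (nab F V X Z) - nab F V (lie F V X Y) Z

/-- The Ricci tensor `Ric(X,Y) = ∑_i g(R(e_i, X)Y, e_i)`. -/
def Ric (X Y : V) : F :=
  ∑ i, gm F V (Rcurv F V (fr F V i) X Y) (fr F V i)

/-- The scalar curvature. -/
def Scal : F := ∑ i, Ric F V (fr F V i) (fr F V i)

/-- `M` is Einstein: `Ric = a g` for a constant `a`. -/
def Einstein : Prop :=
  ∃ a : ℝ, ∀ X Y, Ric F V X Y = algebraMap ℝ F a * gm F V X Y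

/-- `M` is η-Einstein: `Ric = a g + b ∑_α η_α ⊗ η_α` for constants `a, b`. -/
def EtaEinstein : Prop :=
  ∃ a b : ℝ, ∀ X Y, Ric F V X Y
    = algebraMap ℝ F a * gm F V X Y
      + algebraMap ℝ F b * ∑ α : Fin 3, et F V α X * et F V α Y

end curv

/-- A (Koszul) linear connection on vector fields. -/
def IsConnection (F V : Type) [CommRing F] [Algebra ℝ F] [AddCommGroup V] [Module F V]
    [SmoothSetting F V] (D : V → V → V) : Prop :=
  (∀ X Y Z : V, D (X + Y) Z = D X Z + D Y Z) ∧
  (∀ (f : F) (X Y : V), D (f • X) Y = f • D X Y) ∧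
  (∀ X Y Z : V, D X (Y + Z) = D X Y + D X Z) ∧
  (∀ (X : V) (f : F) (Y : V), D X (f • Y) = der F V X f • Y + f • D X Y)

end QS3

namespace QS3

theorem Cyclic.rotate {a b c : Fin 3} (h : Cyclic a b c) : Cyclic b c a := by
  rcases h with h | h | h <;> simp only [Prod.mk.injEq] at h <;>
    obtain ⟨rfl, rfl, rfl⟩ := h <;> simp [Cyclic]

theorem exists_cyclic (a : Fin 3) : ∃ b c, Cyclic a b c := by
  fin_cases a
  exacts [⟨1, 2, by simp [Cyclic]⟩, ⟨2, 0, by simp [Cyclic]⟩, ⟨0, 1, by simp [Cyclic]⟩]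

theorem two_half (F : Type) [CommRing F] [Algebra ℝ F] :
    (2 : F) * algebraMap ℝ F (1 / 2) = 1 := by
  rw [← map_ofNat (algebraMap ℝ F) 2, ← map_mul]
  norm_num

theorem eq_zero_of_two_mul {F : Type} [CommRing F] [Algebra ℝ F] {x : F} (h : 2 * x = 0) :
    x = 0 := by
  linear_combination algebraMap ℝ F (1 / 2) * h - x * two_half F

section derivations

variable (F V : Type) [CommRing F] [Algebra ℝ F] [AddCommGroup V] [Module F V]
  [SmoothSetting F V]

theorem der_add (X : V) (f h : F) : der F V X (f + h) = der F V X f + der F V X h :=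
  SmoothSetting.act_add X f h

theorem der_const (X : V) (r : ℝ) : der F V X (algebraMap ℝ F r) = 0 :=
  SmoothSetting.act_const X r

theorem der_neg (X : V) (f : F) : der F V X (-f) = -der F V X f := by
  have h0 : der F V X 0 = 0 := by simpa using der_const F V X 0
  rw [eq_neg_iff_add_eq_zero, ← der_add, neg_add_cancel, h0]

theorem der_sub_left (X Y : V) (f : F) :
    der F V (X - Y) f = der F V X f - der F V Y f := by
  have h : der F V (X - Y + Y) f = der F V (X - Y) f + der F V Y f :=
    SmoothSetting.act_addLeft _ _ f
  rw [sub_add_cancel] at h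
  rw [h, add_sub_cancel_right]

theorem der_lie (X Y : V) (f : F) :
    der F V (lie F V X Y) f = der F V X (der F V Y f) - der F V Y (der F V X f) :=
  SmoothSetting.bracket_act X Y f

end derivations

section algebraic

variable (F V : Type) [CommRing F] [Algebra ℝ F] [AddCommGroup V] [Module F V]
  [SmoothSetting F V] [ACM3 F V]

/-- The metric as a bilinear map. -/
def metric : V →ₗ[F] V →ₗ[F] F :=
  LinearMap.mk₂ F (gm F V) (fun X Y Z => ACM3.g_addLeft X Y Z)
    (fun f X Y => ACM3.g_smulLeft f X Y)
    (fun X Y Z => by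
      simp only [gm]
      rw [ACM3.g_symm X, ACM3.g_addLeft, ACM3.g_symm Y, ACM3.g_symm Z])
    (fun f X Y => by
      simp only [gm]
      rw [ACM3.g_symm X, ACM3.g_smulLeft, ACM3.g_symm Y, smul_eq_mul])

/-- The structure tensors as linear maps. -/
def phiL (a : Fin 3) : V →ₗ[F] V where
  toFun := ph F V a
  map_add' := ACM3.phi_add a
  map_smul' := ACM3.phi_smul a

/-- The one-forms `η_a` as linear maps. -/
def etaL (a : Fin 3) : V →ₗ[F] F := (metric F V).flip (rxi F V a)

local notation "⟪" X "," Y "⟫" => metric F V X Y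
local notation "φ" => phiL F V
local notation "η" => etaL F V
local notation "ξ" => rxi F V

theorem gm_eq_metric (X Y : V) : gm F V X Y = ⟪X, Y⟫ := rfl

theorem ph_eq_phiL (a : Fin 3) (X : V) : ph F V a X = φ a X := rfl

theorem etaL_apply (a : Fin 3) (X : V) : η a X = ⟪X, ξ a⟫ := rfl

theorem et_eq_etaL (a : Fin 3) (X : V) : et F V a X = η a X := ACM3.eta_eq a X

theorem metric_comm (X Y : V) : ⟪X, Y⟫ = ⟪Y, X⟫ := ACM3.g_symm X Y

variable {F V} in
theorem eq_of_metric_eq {X Y : V} (h : ∀ Z, ⟪X, Z⟫ = ⟪Y, Z⟫) : X = Y := by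
  rw [← sub_eq_zero]
  refine ACM3.g_nondeg (F := F) _ fun Z => ?_
  rw [← gm, gm_eq_metric, map_sub, LinearMap.sub_apply, h, sub_self]

theorem phi_sq (a : Fin 3) (X : V) : φ a (φ a X) = -X + η a X • ξ a := by
  rw [← et_eq_etaL]
  exact ACM3.acm_sq a X

theorem eta_xi_self (a : Fin 3) : η a (ξ a) = 1 := by
  rw [← et_eq_etaL]
  exact ACM3.eta_xi a

theorem metric_phi_phi (a : Fin 3) (X Y : V) :
    ⟪φ a X, φ a Y⟫ = ⟪X, Y⟫ - η a X * η a Y := by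
  rw [← et_eq_etaL, ← et_eq_etaL]
  exact ACM3.compat a X Y

theorem phi_xi_proportional (a : Fin 3) : φ a (ξ a) = η a (φ a (ξ a)) • ξ a := by
  have h1 := phi_sq F V a (φ a (ξ a))
  rw [phi_sq F V a (ξ a), eta_xi_self, one_smul, neg_add_cancel, map_zero] at h1
  exact (neg_add_eq_zero.mp h1.symm)

variable {F V}

theorem Cyclic.phi_xi {a b c : Fin 3} (hc : Cyclic a b c) : φ a (ξ b) = ξ c :=
  (ACM3.quat_xi (F := F) a b c hc).symm

theorem Cyclic.phi_xi' {a b c : Fin 3} (hc : Cyclic a b c) : φ b (ξ a) = -ξ c := by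
  rw [show ξ c = -φ b (ξ a) from ACM3.quat_xi' (F := F) a b c hc, neg_neg]

theorem Cyclic.eta_phi {a b c : Fin 3} (hc : Cyclic a b c) (X : V) :
    η a (φ b X) = η c X := by
  rw [← et_eq_etaL, ← et_eq_etaL]
  exact (ACM3.quat_eta a b c hc X).symm

theorem Cyclic.eta_phi' {a b c : Fin 3} (hc : Cyclic a b c) (X : V) :
    η b (φ a X) = -η c X := by
  rw [← et_eq_etaL, ← et_eq_etaL, eq_neg_iff_add_eq_zero, add_comm, ← eq_neg_iff_add_eq_zero]
  exact ACM3.quat_eta' a b c hc X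

theorem Cyclic.phi_phi {a b c : Fin 3} (hc : Cyclic a b c) (X : V) :
    φ a (φ b X) = φ c X + η b X • ξ a := by
  rw [← et_eq_etaL, ← sub_eq_iff_eq_add]
  exact (ACM3.quat_phi a b c hc X).symm

theorem Cyclic.phi_phi' {a b c : Fin 3} (hc : Cyclic a b c) (X : V) :
    φ b (φ a X) = -φ c X + η a X • ξ b := by
  have h : φ c X = -(φ b (φ a X)) + η a X • ξ b := by
    rw [← et_eq_etaL]
    exact ACM3.quat_phi' a b c hc X
  rw [h]
  abel

theorem eta_xi_comm (a b : Fin 3) : η a (ξ b) = η b (ξ a) := metric_comm F V _ _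

theorem eta_phi_xi_sq (a : Fin 3) : η a (φ a (ξ a)) * η a (φ a (ξ a)) = 0 := by
  have h := phi_sq F V a (ξ a)
  rw [eta_xi_self, one_smul, neg_add_cancel, phi_xi_proportional, map_smul,
    phi_xi_proportional] at h
  simpa [eta_xi_self] using congrArg (η a) h

theorem Cyclic.eta_xi {a b c : Fin 3} (hc : Cyclic a b c) : η a (ξ b) = 0 := by
  have h1 : η a (φ b (ξ b)) = η c (ξ b) := hc.eta_phi (ξ b)
  have h2 : η c (φ b (ξ b)) = -η a (ξ b) := hc.rotate.eta_phi' (ξ b)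
  rw [phi_xi_proportional, map_smul, smul_eq_mul] at h1 h2
  linear_combination η b (φ b (ξ b)) * h1 + h2 - η a (ξ b) * eta_phi_xi_sq (F := F) (V := V) b

theorem Cyclic.eta_xi' {a b c : Fin 3} (hc : Cyclic a b c) : η b (ξ a) = 0 :=
  (eta_xi_comm b a).trans hc.eta_xi

variable (F V)

@[simp]
theorem phi_xi_self (a : Fin 3) : φ a (ξ a) = 0 := by
  obtain ⟨b, c, hc⟩ := exists_cyclic a
  have h : φ a (φ b (ξ c)) = φ c (ξ c) + η b (ξ c) • ξ a := hc.phi_phi (ξ c)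
  rw [hc.rotate.phi_xi, hc.rotate.eta_xi, zero_smul, add_zero] at h
  have h0 : η a (φ c (ξ c)) = 0 := by
    rw [phi_xi_proportional, map_smul, hc.rotate.rotate.eta_xi', smul_zero]
  rw [phi_xi_proportional, h, h0, zero_smul]

@[simp]
theorem eta_phi_self (a : Fin 3) (X : V) : η a (φ a X) = 0 := by
  have h1 := phi_sq F V a (φ a X)
  rw [phi_sq F V a X, map_add, map_neg, map_smul, phi_xi_self, smul_zero, add_zero,
    left_eq_add] at h1
  simpa [eta_xi_self] using congrArg (η a) h1

theorem metric_phi (a : Fin 3) (X Y : V) : ⟪φ a X, Y⟫ = -⟪X, φ a Y⟫ := by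
  have h := metric_phi_phi F V a X (φ a Y)
  rw [phi_sq, eta_phi_self, mul_zero, sub_zero, map_add, map_smul, ← etaL_apply,
    eta_phi_self, smul_zero, add_zero, map_neg] at h
  rw [← h, neg_neg]

theorem metric_xi_right (a : Fin 3) (X : V) : ⟪X, ξ a⟫ = η a X := rfl

theorem metric_xi_left (a : Fin 3) (X : V) : ⟪ξ a, X⟫ = η a X := metric_comm F V _ _

variable [LeviCivita F V]

/-- The Levi-Civita connection, linear in the direction and additive in the argument. -/
def cov : V →ₗ[F] V →+ V where
  toFun X := AddMonoidHom.mk' (nab F V X) (LeviCivita.nabla_addRight X)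
  map_add' X Y := AddMonoidHom.ext fun Z => LeviCivita.nabla_addLeft X Y Z
  map_smul' f X := AddMonoidHom.ext fun Z => LeviCivita.nabla_smulLeft f X Z

local notation "𝒟" => cov F V

theorem nab_eq_cov (X Y : V) : nab F V X Y = 𝒟 X Y := rfl

theorem lie_eq (X Y : V) : lie F V X Y = 𝒟 X Y - 𝒟 Y X :=
  (LeviCivita.nabla_torsionFree X Y).symm

theorem cov_smul (X : V) (f : F) (Y : V) : 𝒟 X (f • Y) = der F V X f • Y + f • 𝒟 X Y :=
  LeviCivita.nabla_leibniz X f Y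

theorem der_metric (X Y Z : V) : der F V X ⟪Y, Z⟫ = ⟪𝒟 X Y, Z⟫ + ⟪Y, 𝒟 X Z⟫ :=
  LeviCivita.nabla_metric X Y Z

theorem der_eta (a : Fin 3) (X Y : V) :
    der F V X (η a Y) = η a (𝒟 X Y) + ⟪𝒟 X (ξ a), Y⟫ := by
  rw [etaL_apply, der_metric, ← etaL_apply, metric_comm F V Y]

theorem eta_cov_xi (a : Fin 3) (X : V) : η a (𝒟 X (ξ a)) = 0 := by
  apply eq_zero_of_two_mul
  have h := der_eta F V a X (ξ a)
  have h1 : der F V X (1 : F) = 0 := by simpa using der_const F V X 1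
  rw [eta_xi_self, h1, metric_xi_right] at h
  rw [two_mul]
  exact h.symm

theorem metric_cov_xi_xi (a : Fin 3) (X : V) : ⟪𝒟 X (ξ a), ξ a⟫ = 0 :=
  eta_cov_xi F V a X

theorem two_mul_dOne (a : Fin 3) (X Y : V) :
    2 * dOne F V (et F V a) X Y = ⟪𝒟 X (ξ a), Y⟫ - ⟪𝒟 Y (ξ a), X⟫ := by
  simp only [dOne, et_eq_etaL, der_eta, lie_eq, map_sub]
  rw [Algebra.smul_def, ← mul_assoc, ← one_div, two_half]
  ring

/-- The covariant derivative of `φ_a`. -/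
def covPhi (a : Fin 3) (X Y : V) : V := 𝒟 X (φ a Y) - φ a (𝒟 X Y)

theorem metric_covPhi (a : Fin 3) (X Y Z : V) :
    ⟪Y, covPhi F V a X Z⟫ = -⟪Z, covPhi F V a X Y⟫ := by
  have h := der_metric F V X Y (φ a Z)
  have h' := der_metric F V X (φ a Y) Z
  rw [metric_phi, der_neg, h] at h'
  simp only [covPhi, map_sub]
  linear_combination -h' - metric_phi F V a (𝒟 X Y) Z - metric_phi F V a Y (𝒟 X Z)
    + metric_comm F V Z (𝒟 X (φ a Y)) - metric_comm F V Z (φ a (𝒟 X Y))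

theorem covPhi_phi (a : Fin 3) (X Y : V) :
    covPhi F V a X (φ a Y) = -φ a (covPhi F V a X Y) + ⟪𝒟 X (ξ a), Y⟫ • ξ a
      + η a Y • 𝒟 X (ξ a) := by
  simp only [covPhi, phi_sq, map_sub, map_add, map_neg, cov_smul, der_eta]
  module

theorem metric_phi_covPhi (a : Fin 3) (W X Z : V) :
    ⟪φ a X, covPhi F V a W Z⟫ = ⟪X, covPhi F V a W (φ a Z)⟫
      - ⟪𝒟 W (ξ a), Z⟫ * η a X - η a Z * ⟪𝒟 W (ξ a), X⟫ := by
  rw [covPhi_phi, metric_phi]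
  simp only [map_add, map_neg, map_smul, smul_eq_mul, metric_xi_right]
  rw [metric_comm F V X (𝒟 W _)]
  ring

theorem metric_covPhi_xi (a : Fin 3) (X Y : V) :
    ⟪Y, covPhi F V a X (ξ a)⟫ = ⟪𝒟 X (ξ a), φ a Y⟫ := by
  simp only [covPhi, phi_xi_self, map_zero, zero_sub, map_neg]
  rw [metric_comm, metric_phi, neg_neg]

theorem eta_covPhi (a : Fin 3) (X Y : V) :
    η a (covPhi F V a X Y) = -⟪𝒟 X (ξ a), φ a Y⟫ := by
  rw [← metric_xi_left, metric_covPhi, metric_covPhi_xi]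

theorem covPhi_phi_phi (a : Fin 3) (X Y : V) :
    covPhi F V a X (φ a (φ a Y)) = -covPhi F V a X Y + η a Y • covPhi F V a X (ξ a) := by
  simp only [covPhi, phi_sq, map_add, map_neg, map_smul, cov_smul]
  module

variable {F V}

theorem IsClosedTwo.covPhi_cyclic {a : Fin 3} (h : IsClosedTwo F V (Phi F V a)) (X Y Z : V) :
    ⟪Y, covPhi F V a X Z⟫ + ⟪Z, covPhi F V a Y X⟫ + ⟪X, covPhi F V a Z Y⟫ = 0 := by
  have h3 : (3 : F) * algebraMap ℝ F (3⁻¹) = 1 := by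
    rw [← map_ofNat (algebraMap ℝ F) 3, ← map_mul]
    norm_num
  have h := h X Y Z
  rw [dTwo, Algebra.smul_def] at h
  simp only [Phi, gm_eq_metric, ph_eq_phiL, lie_eq, der_metric, map_sub,
    LinearMap.sub_apply] at h
  simp only [covPhi, map_sub]
  have e (U W : V) : -⟪U, φ a W⟫ = ⟪W, φ a U⟫ := by rw [← metric_phi, metric_comm]
  replace h := congrArg (3 * ·) h
  simp only [← mul_assoc, h3, one_mul, mul_zero] at h
  linear_combination h + e Y (𝒟 X Z) + e Z (𝒟 Y X) + e X (𝒟 Z Y)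

theorem IsNormal.covPhi_eq {a : Fin 3} (h : IsNormal F V a) (X Y : V) :
    φ a (covPhi F V a Y X) - φ a (covPhi F V a X Y) + covPhi F V a (φ a X) Y
      - covPhi F V a (φ a Y) X + (⟪𝒟 X (ξ a), Y⟫ - ⟪𝒟 Y (ξ a), X⟫) • ξ a = 0 := by
  have h := h X Y
  rw [NOne, Algebra.smul_def, map_ofNat, two_mul_dOne, Nij] at h
  simp only [ph_eq_phiL, lie_eq, map_sub] at h
  rw [← h]
  simp only [covPhi, map_sub]
  abel

theorem Rcurv_eq (X Y Z : V) :
    Rcurv F V X Y Z = 𝒟 X (𝒟 Y Z) - 𝒟 Y (𝒟 X Z) - 𝒟 (𝒟 X Y) Z + 𝒟 (𝒟 Y X) Z := by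
  simp only [Rcurv, nab_eq_cov, lie_eq, map_sub, AddMonoidHom.sub_apply]
  abel

theorem Rcurv_bianchi (X Y Z : V) :
    Rcurv F V X Y Z + Rcurv F V Y Z X + Rcurv F V Z X Y = 0 := by
  have h : lie F V X (lie F V Y Z) + lie F V Y (lie F V Z X) + lie F V Z (lie F V X Y) = 0 :=
    SmoothSetting.jacobi X Y Z
  rw [← h]
  simp only [Rcurv_eq, lie_eq, map_sub, AddMonoidHom.sub_apply]
  abel

theorem metric_Rcurv_skew (X Y Z W : V) :
    ⟪Rcurv F V X Y Z, W⟫ = -⟪Rcurv F V X Y W, Z⟫ := by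
  have h := der_lie F V X Y ⟪Z, W⟫
  simp only [der_metric, der_add] at h
  rw [metric_comm F V (Rcurv F V X Y W)]
  simp only [Rcurv, nab_eq_cov, map_sub, LinearMap.sub_apply]
  linear_combination -h

theorem IsNormal.dEta_phi_phi {a : Fin 3} (h : IsNormal F V a) (X Y : V) :
    ⟪𝒟 (φ a X) (ξ a), φ a Y⟫ - ⟪𝒟 (φ a Y) (ξ a), φ a X⟫
      = ⟪𝒟 X (ξ a), Y⟫ - ⟪𝒟 Y (ξ a), X⟫ := by
  have h := congrArg (metric F V (ξ a)) (h.covPhi_eq X Y)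
  simp only [map_add, map_sub, map_smul, metric_xi_left, eta_covPhi, eta_phi_self,
    eta_xi_self, smul_eq_mul, map_zero] at h
  linear_combination -h

theorem IsNormal.metric_cov_xi_left {a : Fin 3} (h : IsNormal F V a) (X : V) :
    ⟪𝒟 (ξ a) (ξ a), X⟫ = 0 := by
  have h := h.dEta_phi_phi X (ξ a)
  simp only [phi_xi_self, map_zero, AddMonoidHom.zero_apply, LinearMap.zero_apply,
    metric_cov_xi_xi] at h
  linear_combination h

theorem IsNormal.dEta_phi {a : Fin 3} (h : IsNormal F V a) (X Y : V) :
    ⟪𝒟 (φ a X) (ξ a), Y⟫ - ⟪𝒟 Y (ξ a), φ a X⟫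
      + ⟪𝒟 X (ξ a), φ a Y⟫ - ⟪𝒟 (φ a Y) (ξ a), X⟫ = 0 := by
  have h2 := h.metric_cov_xi_left (φ a X)
  have h := h.dEta_phi_phi X (φ a Y)
  simp only [phi_sq, map_add, map_neg, map_smul, AddMonoidHom.add_apply, AddMonoidHom.neg_apply,
    AddMonoidHom.smul_apply, LinearMap.add_apply, LinearMap.neg_apply, LinearMap.smul_apply,
    metric_cov_xi_xi, h2, smul_eq_mul] at h
  linear_combination -h

theorem IsQuasiSasakian.two_mul_metric_covPhi {a : Fin 3} (h : IsQuasiSasakian F V a)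
    (X Y Z : V) :
    2 * ⟪Y, covPhi F V a X Z⟫ =
      η a Z * (⟪𝒟 X (ξ a), φ a Y⟫ - ⟪𝒟 (φ a Y) (ξ a), X⟫)
        - η a Y * (⟪𝒟 X (ξ a), φ a Z⟫ - ⟪𝒟 (φ a Z) (ξ a), X⟫) := by
  have hN := congrArg (metric F V (φ a X)) (h.1.covPhi_eq Y Z)
  simp only [map_add, map_sub, map_smul, metric_phi_phi, metric_phi_covPhi,
    metric_xi_right, eta_phi_self, smul_eq_mul, mul_zero, add_zero, map_zero] at hN
  rw [eta_covPhi, eta_covPhi] at hN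
  have hc1 := h.2.covPhi_cyclic X Y Z
  have hc2 := h.2.covPhi_cyclic X (φ a Y) (φ a Z)
  have hx := metric_phi_covPhi F V a X Y (φ a Z)
  rw [covPhi_phi_phi, eta_phi_self] at hx
  simp only [map_add, map_neg, map_smul, smul_eq_mul, metric_covPhi_xi] at hx
  have hd := h.1.dEta_phi Y Z
  have hs1 := metric_covPhi F V a Y X Z
  have hs2 := metric_covPhi F V a (φ a Y) X (φ a Z)
  linear_combination -hN + hc1 - hc2 + hx - η a X * hd - hs1 + hs2

theorem IsQuasiSasakian.metric_cov_xi_phi {a : Fin 3} (h : IsQuasiSasakian F V a) (X Y : V) :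
    ⟪𝒟 (φ a Y) (ξ a), X⟫ = -⟪𝒟 X (ξ a), φ a Y⟫ := by
  have h1 := h.two_mul_metric_covPhi X (ξ a) Y
  simp only [metric_xi_left, eta_covPhi, phi_xi_self, map_zero, AddMonoidHom.zero_apply,
    LinearMap.zero_apply, eta_xi_self] at h1
  linear_combination -h1

theorem IsQuasiSasakian.metric_covPhi_eq {a : Fin 3} (h : IsQuasiSasakian F V a) (X Y Z : V) :
    ⟪Y, covPhi F V a X Z⟫ = η a Z * ⟪𝒟 X (ξ a), φ a Y⟫ - η a Y * ⟪𝒟 X (ξ a), φ a Z⟫ := by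
  have h2 := h.two_mul_metric_covPhi X Y Z
  rw [h.metric_cov_xi_phi, h.metric_cov_xi_phi] at h2
  rw [← sub_eq_zero]
  apply eq_zero_of_two_mul
  linear_combination h2

variable (F V) in
/-- The symmetric endomorphism `X ↦ -φ_a (∇_X ξ_a)` attached to one structure. -/
def shapeOne (a : Fin 3) : V →ₗ[F] V where
  toFun X := -φ a (𝒟 X (ξ a))
  map_add' X Y := by simp only [map_add, AddMonoidHom.add_apply, neg_add]
  map_smul' f X := by
    simp only [map_smul, AddMonoidHom.smul_apply, RingHom.id_apply, smul_neg]

theorem metric_shapeOne (a : Fin 3) (X Y : V) :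
    ⟪shapeOne F V a X, Y⟫ = ⟪𝒟 X (ξ a), φ a Y⟫ := by
  simp only [shapeOne, LinearMap.coe_mk, AddHom.coe_mk, map_neg, LinearMap.neg_apply,
    metric_phi, neg_neg]

theorem cov_xi_eq_phi_shapeOne (a : Fin 3) (X : V) : 𝒟 X (ξ a) = φ a (shapeOne F V a X) := by
  simp only [shapeOne, LinearMap.coe_mk, AddHom.coe_mk, map_neg, phi_sq, eta_cov_xi]
  module

theorem eta_shapeOne (a : Fin 3) (X : V) : η a (shapeOne F V a X) = 0 := by
  simp only [shapeOne, LinearMap.coe_mk, AddHom.coe_mk, map_neg, eta_phi_self, neg_zero]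

theorem IsNormal.shapeOne_xi {a : Fin 3} (h : IsNormal F V a) : shapeOne F V a (ξ a) = 0 :=
  eq_of_metric_eq (F := F) fun Z => by
    rw [metric_shapeOne, h.metric_cov_xi_left, map_zero, LinearMap.zero_apply]

theorem IsQuasiSasakian.metric_cov_xi_phi_left {a : Fin 3} (h : IsQuasiSasakian F V a)
    (X Y : V) : ⟪𝒟 (φ a X) (ξ a), Y⟫ = -⟪𝒟 X (ξ a), φ a Y⟫ := by
  have h1 := h.1.dEta_phi X Y
  rw [h.metric_cov_xi_phi Y X, h.metric_cov_xi_phi X Y] at h1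
  rw [h.metric_cov_xi_phi Y X, ← sub_eq_zero]
  apply eq_zero_of_two_mul
  linear_combination h1

theorem IsQuasiSasakian.metric_shapeOne_comm {a : Fin 3} (h : IsQuasiSasakian F V a)
    (X Y : V) : ⟪shapeOne F V a X, Y⟫ = ⟪X, shapeOne F V a Y⟫ := by
  rw [metric_comm F V X, metric_shapeOne, metric_shapeOne]
  linear_combination h.metric_cov_xi_phi_left X Y - h.metric_cov_xi_phi Y X

theorem IsQuasiSasakian.shapeOne_phi {a : Fin 3} (h : IsQuasiSasakian F V a) (X : V) :
    shapeOne F V a (φ a X) = φ a (shapeOne F V a X) :=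
  eq_of_metric_eq (F := F) fun Z => by
    rw [metric_shapeOne, ← cov_xi_eq_phi_shapeOne, h.metric_cov_xi_phi_left, phi_sq]
    simp only [map_add, map_neg, map_smul, metric_cov_xi_xi, smul_zero, add_zero, neg_neg]

theorem IsQuasiSasakian.covPhi_eq {a : Fin 3} (h : IsQuasiSasakian F V a) (X Y : V) :
    covPhi F V a X Y = η a Y • shapeOne F V a X - ⟪shapeOne F V a X, Y⟫ • ξ a :=
  eq_of_metric_eq (F := F) fun Z => by
    rw [metric_comm, h.metric_covPhi_eq]
    simp only [map_sub, map_smul, LinearMap.sub_apply, LinearMap.smul_apply, smul_eq_mul,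
      metric_shapeOne, metric_xi_left]
    ring

theorem Cyclic.covPhi {a b c : Fin 3} (hc : Cyclic a b c) (X Y : V) :
    covPhi F V c X Y = covPhi F V a X (φ b Y) + φ a (covPhi F V b X Y)
      - ⟪𝒟 X (ξ b), Y⟫ • ξ a - η b Y • 𝒟 X (ξ a) := by
  have h (Z : V) : φ c Z = φ a (φ b Z) - η b Z • ξ a := by rw [hc.phi_phi]; module
  simp only [QS3.covPhi, h, map_sub, cov_smul, der_eta]
  module

section threeQS

variable [ThreeQS F V]

theorem Cyclic.eta_shapeOne {a b c : Fin 3} (hc : Cyclic a b c) (X : V) :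
    η c (shapeOne F V a X) = η c (shapeOne F V b X) := by
  have h := congrArg (η a) (hc.covPhi (F := F) X (ξ a))
  simp only [(ThreeQS.qs (F := F) (V := V) _).covPhi_eq, hc.phi_xi', map_sub, map_add, map_smul,
    map_neg, smul_eq_mul, hc.eta_xi', hc.rotate.rotate.eta_xi, hc.rotate.rotate.eta_xi',
    eta_xi_self, cov_xi_eq_phi_shapeOne, metric_xi_right, hc.eta_phi,
    QS3.eta_shapeOne, eta_phi_self] at h
  linear_combination -h

theorem Cyclic.shapeOne_eq_add {a b c : Fin 3} (hc : Cyclic a b c) (X : V) :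
    shapeOne F V c X = shapeOne F V a X - η c (shapeOne F V b X) • ξ c
      + η a (shapeOne F V b X) • ξ a := by
  have h := hc.covPhi (F := F) X (ξ c)
  simp only [(ThreeQS.qs (F := F) (V := V) _).covPhi_eq, hc.rotate.phi_xi, map_sub, map_smul,
    hc.rotate.eta_xi, eta_xi_self, cov_xi_eq_phi_shapeOne, metric_xi_right,
    QS3.eta_shapeOne, hc.rotate.eta_phi', hc.phi_xi, one_smul, zero_smul, sub_zero,
    map_zero] at h
  rw [h]
  module

/-- The common eigenvalue of the endomorphisms `shapeOne` on the Reeb vector fields. -/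
def kap (F V : Type) [CommRing F] [Algebra ℝ F] [AddCommGroup V] [Module F V]
    [SmoothSetting F V] [ACM3 F V] [ThreeQS F V] : F :=
  algebraMap ℝ F (-(cc F V / 2))

local notation "κ" => kap F V

theorem Cyclic.shapeOne_xi_eq {a b c : Fin 3} (hc : Cyclic a b c) :
    shapeOne F V a (ξ c) = shapeOne F V b (ξ c) := by
  have h := hc.rotate.shapeOne_eq_add (F := F) (ξ c)
  rw [(ThreeQS.qs (F := F) (V := V) c).1.shapeOne_xi] at h
  simpa using h

theorem Cyclic.shapeOne_xi_smul {a b c : Fin 3} (hc : Cyclic a b c) :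
    shapeOne F V a (ξ c) = η c (shapeOne F V a (ξ c)) • ξ c := by
  have h := hc.shapeOne_eq_add (F := F) (ξ c)
  rw [(ThreeQS.qs (F := F) (V := V) c).1.shapeOne_xi, ← hc.shapeOne_xi_eq, QS3.eta_shapeOne,
    zero_smul, add_zero] at h
  exact (sub_eq_zero.mp h.symm)

theorem Cyclic.eta_shapeOne_add {a b c : Fin 3} (hc : Cyclic a b c) :
    η c (shapeOne F V a (ξ c)) + η a (shapeOne F V b (ξ a)) = 2 * κ := by
  have h : lie F V (ξ c) (ξ a) = algebraMap ℝ F (cc F V) • ξ b :=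
    ThreeQS.reeb_bracket c a b hc.rotate.rotate
  have hr : shapeOne F V c (ξ a) = shapeOne F V b (ξ a) := hc.rotate.shapeOne_xi_eq.symm
  rw [lie_eq, cov_xi_eq_phi_shapeOne, cov_xi_eq_phi_shapeOne, hr,
    hc.shapeOne_xi_smul, hc.rotate.shapeOne_xi_smul] at h
  simp only [map_smul, hc.rotate.rotate.phi_xi, hc.rotate.rotate.phi_xi'] at h
  have h := congrArg (η b) h
  simp only [map_sub, map_smul, map_neg, eta_xi_self, smul_eq_mul] at h
  have hk : 2 * κ = -algebraMap ℝ F (cc F V) := by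
    rw [kap, ← map_ofNat (algebraMap ℝ F) 2, ← map_mul, ← map_neg]
    congr 1
    ring
  rw [hk]
  linear_combination -h

theorem Cyclic.shapeOne_xi {a b c : Fin 3} (hc : Cyclic a b c) :
    shapeOne F V a (ξ c) = κ • ξ c := by
  have h1 := hc.eta_shapeOne_add (F := F) (V := V)
  have h2 := hc.rotate.eta_shapeOne_add (F := F) (V := V)
  have h3 := hc.rotate.rotate.eta_shapeOne_add (F := F) (V := V)
  rw [hc.shapeOne_xi_smul]
  congr 1
  rw [← sub_eq_zero]
  apply eq_zero_of_two_mul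
  linear_combination h1 - h2 + h3

theorem Cyclic.shapeOne_xi' {a b c : Fin 3} (hc : Cyclic a b c) :
    shapeOne F V b (ξ c) = κ • ξ c := by
  rw [← hc.shapeOne_xi_eq, hc.shapeOne_xi]

theorem Cyclic.shapeOne_add {a b c : Fin 3} (hc : Cyclic a b c) (X : V) :
    shapeOne F V a X + (κ * η a X) • ξ a = shapeOne F V c X + (κ * η c X) • ξ c := by
  have h1 : η c (shapeOne F V b X) = κ * η c X := by
    rw [etaL_apply, (ThreeQS.qs (F := F) (V := V) b).metric_shapeOne_comm, hc.shapeOne_xi',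
      map_smul, smul_eq_mul, etaL_apply]
  have h2 : η a (shapeOne F V b X) = κ * η a X := by
    rw [etaL_apply, (ThreeQS.qs (F := F) (V := V) b).metric_shapeOne_comm, hc.rotate.shapeOne_xi,
      map_smul, smul_eq_mul, etaL_apply]
  rw [hc.shapeOne_eq_add, h1, h2]
  module

variable (F V) in
/-- The endomorphism `A` governing the geometry: `∇_X ξ_a = φ_a (A X)` for every `a`. -/
def shape : V →ₗ[F] V := shapeOne F V 0 + κ • (η 0).smulRight (ξ 0)

local notation "𝒜" => shape F V

theorem shape_eq (a : Fin 3) (X : V) : 𝒜 X = shapeOne F V a X + (κ * η a X) • ξ a := by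
  have h0 : 𝒜 X = shapeOne F V 0 X + (κ * η 0 X) • ξ 0 := by
    simp only [shape, LinearMap.add_apply, LinearMap.smul_apply, LinearMap.smulRight_apply,
      smul_smul]
  have h1 : Cyclic 1 2 0 := by simp [Cyclic]
  have h2 : Cyclic 0 1 2 := by simp [Cyclic]
  fin_cases a
  · exact h0
  · exact h0.trans (h1.shapeOne_add X).symm
  · exact h0.trans (h2.shapeOne_add X)

theorem metric_shape_comm (X Y : V) : ⟪𝒜 X, Y⟫ = ⟪X, 𝒜 Y⟫ := by
  have h := (ThreeQS.qs (F := F) (V := V) 0).metric_shapeOne_comm X Y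
  simp only [shape_eq 0, map_add, map_smul, LinearMap.add_apply, LinearMap.smul_apply,
    smul_eq_mul, metric_xi_left, metric_xi_right]
  linear_combination h

@[simp]
theorem shape_xi (a : Fin 3) : 𝒜 (ξ a) = κ • ξ a := by
  rw [shape_eq a, (ThreeQS.qs (F := F) (V := V) a).1.shapeOne_xi, eta_xi_self, mul_one, zero_add]

theorem eta_shape (a : Fin 3) (X : V) : η a (𝒜 X) = κ * η a X := by
  rw [etaL_apply, metric_shape_comm, shape_xi, map_smul, smul_eq_mul, etaL_apply]

theorem shape_phi (a : Fin 3) (X : V) : 𝒜 (φ a X) = φ a (𝒜 X) := by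
  simp only [shape_eq a, (ThreeQS.qs (F := F) (V := V) a).shapeOne_phi, eta_phi_self, map_add,
    map_smul, phi_xi_self]
  module

theorem cov_xi (a : Fin 3) (X : V) : 𝒟 X (ξ a) = φ a (𝒜 X) := by
  rw [shape_eq a, map_add, map_smul, phi_xi_self, smul_zero, add_zero, cov_xi_eq_phi_shapeOne]

theorem cov_phi (a : Fin 3) (X Y : V) :
    𝒟 X (φ a Y) = φ a (𝒟 X Y) + η a Y • 𝒜 X - ⟪𝒜 X, Y⟫ • ξ a := by
  have h := (ThreeQS.qs (F := F) (V := V) a).covPhi_eq X Y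
  rw [covPhi, sub_eq_iff_eq_add] at h
  rw [h]
  simp only [shape_eq a, map_add, map_smul, LinearMap.add_apply, LinearMap.smul_apply,
    smul_eq_mul, metric_xi_left]
  module

variable (F V) in
/-- The covariant derivative of `A`. -/
def covShape : V →ₗ[F] V →ₗ[F] V :=
  LinearMap.mk₂ F (fun X Y => 𝒟 X (𝒜 Y) - 𝒜 (𝒟 X Y))
    (fun X Y Z => by simp only [map_add, AddMonoidHom.add_apply]; abel)
    (fun f X Y => by simp only [map_smul, AddMonoidHom.smul_apply]; module)
    (fun X Y Z => by simp only [map_add]; abel)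
    (fun f X Y => by simp only [map_smul, map_add, cov_smul]; module)

theorem cov_shape (X Y : V) : 𝒟 X (𝒜 Y) = 𝒜 (𝒟 X Y) + covShape F V X Y := by
  simp only [covShape, LinearMap.mk₂_apply]
  abel

theorem metric_covShape_comm (X Y Z : V) :
    ⟪covShape F V X Y, Z⟫ = ⟪covShape F V X Z, Y⟫ := by
  have h1 := der_metric F V X (𝒜 Y) Z
  have h2 := der_metric F V X Y (𝒜 Z)
  rw [metric_shape_comm (F := F) Y Z, h2, cov_shape, cov_shape] at h1
  simp only [map_add, LinearMap.add_apply] at h1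
  rw [metric_comm F V _ Y]
  linear_combination -h1 - metric_shape_comm (F := F) (𝒟 X Y) Z
    - metric_shape_comm (F := F) Y (𝒟 X Z)

theorem covShape_phi (a : Fin 3) (X Y : V) :
    covShape F V X (φ a Y) = φ a (covShape F V X Y) + η a Y • (κ • 𝒜 X - 𝒜 (𝒜 X))
      + (κ * ⟪𝒜 X, Y⟫ - ⟪𝒜 X, 𝒜 Y⟫) • ξ a := by
  have h : 𝒟 X (φ a (𝒜 Y)) = 𝒟 X (𝒜 (φ a Y)) := by rw [shape_phi]
  rw [cov_shape, cov_phi, cov_phi, cov_shape] at h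
  simp only [map_add, map_sub, map_smul, shape_phi, shape_xi, eta_shape] at h
  linear_combination (norm := module) -h

theorem covShape_xi (a : Fin 3) (X : V) :
    covShape F V X (ξ a) = φ a (κ • 𝒜 X - 𝒜 (𝒜 X)) := by
  have h := cov_shape (F := F) X (ξ a)
  have hk : der F V X κ = 0 := der_const F V X _
  rw [shape_xi, cov_smul, hk, cov_xi, shape_phi] at h
  simp only [map_sub, map_smul]
  linear_combination (norm := module) -h

theorem Rcurv_xi (a : Fin 3) (X Y : V) :
    Rcurv F V X Y (ξ a) = φ a (covShape F V X Y - covShape F V Y X)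
      + (κ * η a Y) • 𝒜 X - (κ * η a X) • 𝒜 Y := by
  simp only [Rcurv_eq, cov_xi, cov_phi, cov_shape, map_add, map_sub, eta_shape]
  rw [metric_comm F V (𝒜 Y)]
  abel

theorem covShape_cyclic (a : Fin 3) (X Y Z : V) :
    ⟪covShape F V X Y, φ a Z⟫ + ⟪covShape F V Y Z, φ a X⟫ + ⟪covShape F V Z X, φ a Y⟫
      = η a Z * (κ * ⟪𝒜 X, Y⟫ - ⟪𝒜 X, 𝒜 Y⟫) + η a X * (κ * ⟪𝒜 Y, Z⟫ - ⟪𝒜 Y, 𝒜 Z⟫)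
        + η a Y * (κ * ⟪𝒜 Z, X⟫ - ⟪𝒜 Z, 𝒜 X⟫) := by
  have hb := congrArg (metric F V (ξ a)) (Rcurv_bianchi (F := F) X Y Z)
  have hs (X Y Z : V) : ⟪ξ a, Rcurv F V X Y Z⟫
      = ⟪covShape F V X Y, φ a Z⟫ - ⟪covShape F V Y X, φ a Z⟫
        - (κ * η a Y) * ⟪𝒜 X, Z⟫ + (κ * η a X) * ⟪𝒜 Y, Z⟫ := by
    rw [metric_comm, metric_Rcurv_skew, Rcurv_xi]
    simp only [map_add, map_sub, map_smul, LinearMap.add_apply, LinearMap.sub_apply,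
      LinearMap.smul_apply, smul_eq_mul, metric_phi]
    ring
  have hc (X Y Z : V) : ⟪covShape F V X Y, φ a Z⟫ = -⟪covShape F V X Z, φ a Y⟫
      + η a Z * (κ * ⟪𝒜 X, Y⟫ - ⟪𝒜 X, 𝒜 Y⟫) + η a Y * (κ * ⟪𝒜 X, Z⟫ - ⟪𝒜 X, 𝒜 Z⟫) := by
    rw [metric_covShape_comm, covShape_phi]
    simp only [map_add, map_sub, map_smul, LinearMap.add_apply, LinearMap.sub_apply,
      LinearMap.smul_apply, smul_eq_mul, metric_phi, metric_xi_left, metric_shape_comm (𝒜 X) Y]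
    ring
  have hm (X Y : V) : ⟪𝒜 X, Y⟫ = ⟪𝒜 Y, X⟫ := by rw [metric_shape_comm, metric_comm]
  have hm' (X Y : V) : ⟪𝒜 X, 𝒜 Y⟫ = ⟪𝒜 Y, 𝒜 X⟫ := metric_comm F V _ _
  simp only [map_add, hs, map_zero] at hb
  rw [← sub_eq_zero]
  apply eq_zero_of_two_mul
  have h1 := hc Y X Z
  have h2 := hc Z Y X
  have h3 := hc X Z Y
  rw [hm Y X, hm' Y X] at h1
  rw [hm Z Y, hm' Z Y] at h2
  rw [hm X Z, hm' X Z] at h3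
  rw [hm Y X, hm Z Y, hm X Z] at hb
  linear_combination hb + h1 + h2 + h3

theorem metric_covShape_xi_left (a : Fin 3) (X Y : V) : ⟪covShape F V (ξ a) X, Y⟫ = 0 := by
  have key (X Y : V) : ⟪covShape F V (ξ a) X, φ a Y⟫ = 0 := by
    have h := covShape_cyclic (F := F) a X Y (ξ a)
    simp only [covShape_xi, phi_xi_self, metric_phi_phi, shape_xi, map_smul, map_sub, map_zero,
      LinearMap.sub_apply, LinearMap.smul_apply, smul_eq_mul, eta_shape, metric_xi_left,
      metric_xi_right, eta_xi_self, metric_shape_comm (𝒜 Y)] at h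
    rw [metric_comm F V (𝒜 Y) X, ← metric_shape_comm, metric_comm F V (𝒜 Y) (𝒜 X)] at h
    linear_combination h
  have hx : ⟪covShape F V (ξ a) X, ξ a⟫ = 0 := by
    rw [metric_covShape_comm, covShape_xi, shape_xi, map_smul, shape_xi, sub_self, map_zero,
      map_zero, LinearMap.zero_apply]
  have h := key X (φ a Y)
  simp only [phi_sq, map_add, map_neg, map_smul, hx, smul_zero, add_zero] at h
  linear_combination -h

theorem shape_shape (X : V) : 𝒜 (𝒜 X) = κ • 𝒜 X := by
  have hc : Cyclic 0 1 2 := by simp [Cyclic]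
  set Q : V := κ • 𝒜 X - 𝒜 (𝒜 X) with hQ
  have hη (a : Fin 3) : η a Q = 0 := by
    simp only [hQ, map_sub, map_smul, eta_shape, smul_eq_mul, sub_self]
  have key (Y : V) : ⟪φ 2 Q, Y⟫ = 0 := by
    have h := covShape_cyclic (F := F) 0 X Y (ξ 1)
    rw [hc.phi_xi, metric_covShape_comm, covShape_xi, covShape_xi, metric_covShape_xi_left,
      hc.eta_xi, ← hQ, metric_comm F V _ (φ 0 X)] at h
    have h1 : ⟪φ 0 X, φ 1 (κ • 𝒜 Y - 𝒜 (𝒜 Y))⟫ = ⟪φ 2 Q, Y⟫ := by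
      rw [metric_phi, hc.phi_phi, metric_phi, hQ]
      simp only [map_add, map_sub, map_smul, eta_shape, smul_eq_mul, LinearMap.sub_apply,
        LinearMap.smul_apply, metric_shape_comm, shape_phi]
      simp
    rw [h1] at h
    apply eq_zero_of_two_mul
    simp only [shape_xi, map_smul, LinearMap.smul_apply, metric_xi_left, metric_xi_right,
      eta_shape, smul_eq_mul] at h
    linear_combination h
  have h2 : φ 2 Q = 0 := eq_of_metric_eq (F := F) fun Z => by
    rw [key, map_zero, LinearMap.zero_apply]
  have h3 := phi_sq F V 2 Q
  rw [h2, hη, zero_smul, map_zero, add_zero] at h3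
  exact (sub_eq_zero.mp (neg_eq_zero.mp h3.symm)).symm

theorem metric_shape_shape (X Y : V) : ⟪𝒜 X, 𝒜 Y⟫ = κ * ⟪𝒜 X, Y⟫ := by
  rw [← metric_shape_comm, shape_shape, map_smul, LinearMap.smul_apply, smul_eq_mul]

theorem covShape_eq_zero (X Y : V) : covShape F V X Y = 0 := by
  have hxi (a : Fin 3) (X : V) : covShape F V X (ξ a) = 0 := by
    rw [covShape_xi, shape_shape, sub_self, map_zero]
  have hxi' (a : Fin 3) (X : V) : covShape F V (ξ a) X = 0 :=
    eq_of_metric_eq (F := F) fun Z => by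
      rw [metric_covShape_xi_left, map_zero, LinearMap.zero_apply]
  have hphi (a : Fin 3) (X Y : V) : covShape F V X (φ a Y) = φ a (covShape F V X Y) := by
    rw [covShape_phi, shape_shape, metric_shape_shape, sub_self, sub_self, smul_zero, zero_smul,
      add_zero, add_zero]
  have hcyc (a : Fin 3) (X Y Z : V) : ⟪covShape F V X Y, φ a Z⟫ + ⟪covShape F V Y Z, φ a X⟫
      + ⟪covShape F V Z X, φ a Y⟫ = 0 := by
    simp only [covShape_cyclic, metric_shape_shape, sub_self, mul_zero, add_zero]
  have hinv (a : Fin 3) (X Y Z : V) :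
      ⟪covShape F V X (φ a Y), φ a Z⟫ = ⟪covShape F V X Y, Z⟫ := by
    have h0 : η a (covShape F V X Y) = 0 := by
      rw [etaL_apply, metric_covShape_comm, hxi, map_zero, LinearMap.zero_apply]
    rw [hphi, metric_phi_phi, h0, zero_mul, sub_zero]
  have hskew (a : Fin 3) (X Y Z : V) :
      ⟪covShape F V Z (φ a Y), φ a X⟫ - ⟪covShape F V (φ a Y) Z, φ a X⟫
        = ⟪covShape F V X Y, Z⟫ := by
    have h := hcyc a X (φ a Y) Z
    have h1 : ⟪covShape F V Z X, φ a (φ a Y)⟫ = -⟪covShape F V Z (φ a Y), φ a X⟫ := by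
      rw [metric_covShape_comm, hphi a Z (φ a Y), metric_phi]
    rw [hinv, h1] at h
    linear_combination -h
  have hxi3 (a : Fin 3) (X Y : V) : ⟪covShape F V X Y, ξ a⟫ = 0 := by
    rw [metric_covShape_comm, hxi, map_zero, LinearMap.zero_apply]
  have hc : Cyclic 0 1 2 := by simp [Cyclic]
  have hT (X Y Z : V) :
      ⟪covShape F V Z Y, X⟫ - ⟪covShape F V Y Z, X⟫ = ⟪covShape F V X Y, Z⟫ := by
    have h0 := hskew 0 (φ 0 X) (φ 0 Y) Z
    have h1 := hskew 1 (φ 0 X) (φ 0 Y) Z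
    simp only [phi_sq, hc.phi_phi', map_add, map_neg, map_smul, LinearMap.add_apply,
      LinearMap.neg_apply, LinearMap.smul_apply, hxi, hxi', hxi3, smul_zero, add_zero,
      neg_neg] at h0 h1
    linear_combination h0 - h1 + hskew 2 X Y Z
  refine eq_of_metric_eq (F := F) fun Z => ?_
  rw [map_zero, LinearMap.zero_apply]
  apply eq_zero_of_two_mul
  linear_combination -hT X Y Z - hT X Z Y - metric_covShape_comm (F := F) X Z Y

theorem cov_shape_eq (X Y : V) : 𝒟 X (𝒜 Y) = 𝒜 (𝒟 X Y) := by
  rw [cov_shape, covShape_eq_zero, add_zero]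

variable (F V) in
/-- The part of the curvature not accounted for by the endomorphism `A`. -/
def residual : V →ₗ[F] V →ₗ[F] V →ₗ[F] V :=
  LinearMap.mk₂ F
    (fun X Y =>
      { toFun := fun Z => Rcurv F V X Y Z - (⟪𝒜 Y, Z⟫ • 𝒜 X - ⟪𝒜 X, Z⟫ • 𝒜 Y)
        map_add' := fun Z W => by
          simp only [Rcurv_eq, map_add]
          module
        map_smul' := fun f Z => by
          have h := der_lie F V X Y f
          rw [lie_eq, der_sub_left] at h
          simp only [Rcurv_eq, map_smul, cov_smul, map_add, smul_eq_mul, RingHom.id_apply]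
          linear_combination (norm := module) -h • Z })
    (fun X X' Y => LinearMap.ext fun Z => by
      simp only [Rcurv_eq, map_add, AddMonoidHom.add_apply, LinearMap.add_apply,
        LinearMap.coe_mk, AddHom.coe_mk]
      module)
    (fun f X Y => LinearMap.ext fun Z => by
      simp only [Rcurv_eq, map_add, map_smul, cov_smul, AddMonoidHom.add_apply,
        AddMonoidHom.smul_apply, LinearMap.smul_apply, smul_eq_mul, LinearMap.coe_mk,
        AddHom.coe_mk]
      module)
    (fun X Y Y' => LinearMap.ext fun Z => by
      simp only [Rcurv_eq, map_add, AddMonoidHom.add_apply, LinearMap.add_apply,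
        LinearMap.coe_mk, AddHom.coe_mk]
      module)
    (fun f X Y => LinearMap.ext fun Z => by
      simp only [Rcurv_eq, map_add, map_smul, cov_smul, AddMonoidHom.add_apply,
        AddMonoidHom.smul_apply, LinearMap.smul_apply, smul_eq_mul, LinearMap.coe_mk,
        AddHom.coe_mk]
      module)

local notation "𝒮" => residual F V

theorem residual_apply (X Y Z : V) :
    𝒮 X Y Z = Rcurv F V X Y Z - (⟪𝒜 Y, Z⟫ • 𝒜 X - ⟪𝒜 X, Z⟫ • 𝒜 Y) := rfl

theorem residual_skew (X Y Z : V) : 𝒮 X Y Z = -𝒮 Y X Z := by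
  simp only [residual_apply, Rcurv_eq]
  module

theorem residual_bianchi (X Y Z : V) : 𝒮 X Y Z + 𝒮 Y Z X + 𝒮 Z X Y = 0 := by
  have hm (X Y : V) : ⟪𝒜 X, Y⟫ = ⟪𝒜 Y, X⟫ := by rw [metric_shape_comm, metric_comm]
  simp only [residual_apply, hm Z X, hm Y X, hm Z Y]
  linear_combination (norm := module) Rcurv_bianchi (F := F) X Y Z

theorem metric_residual_skew (X Y Z W : V) : ⟪𝒮 X Y Z, W⟫ = -⟪𝒮 X Y W, Z⟫ := by
  have h := metric_Rcurv_skew (F := F) X Y Z W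
  simp only [residual_apply, map_sub, map_smul, LinearMap.sub_apply, LinearMap.smul_apply,
    smul_eq_mul]
  linear_combination h

theorem metric_residual_pair (X Y Z W : V) : ⟪𝒮 X Y Z, W⟫ = ⟪𝒮 Z W X, Y⟫ := by
  have hb (X Y Z W : V) : ⟪𝒮 X Y Z, W⟫ + ⟪𝒮 Y Z X, W⟫ + ⟪𝒮 Z X Y, W⟫ = 0 := by
    have h := congrArg (metric F V · W) (residual_bianchi (F := F) X Y Z)
    simpa only [map_add, LinearMap.add_apply, map_zero, LinearMap.zero_apply] using h
  have hs (X Y Z W : V) : ⟪𝒮 X Y Z, W⟫ = -⟪𝒮 Y X Z, W⟫ := by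
    rw [residual_skew, map_neg, LinearMap.neg_apply]
  have ht := metric_residual_skew (F := F) (V := V)
  rw [← sub_eq_zero]
  apply eq_zero_of_two_mul
  linear_combination hb X Y Z W + hb Y Z W X - hb Z W X Y - hb W X Y Z - ht Y Z W X - ht Z W Y X
    - hs W Y Z X + hs W X Z Y - ht X W Z Y + hs X Z W Y - ht Z X W Y + hs W X Y Z + ht X Y W Z
    + ht Y W X Z

theorem residual_xi (a : Fin 3) (X Y : V) : 𝒮 X Y (ξ a) = 0 := by
  rw [residual_apply, Rcurv_xi, covShape_eq_zero, covShape_eq_zero, sub_self, map_zero,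
    metric_xi_right, metric_xi_right, eta_shape, eta_shape]
  abel

theorem residual_phi (a : Fin 3) (X Y Z : V) : 𝒮 X Y (φ a Z) = φ a (𝒮 X Y Z) := by
  have hm (X Y : V) : ⟪𝒜 X, φ a Y⟫ = -⟪φ a (𝒜 X), Y⟫ := by rw [metric_phi, neg_neg]
  simp only [residual_apply, Rcurv_eq, cov_phi, cov_xi, cov_smul, cov_shape_eq, der_metric,
    der_eta, map_add, map_sub, map_smul, hm]
  module

theorem etaL_residual (a : Fin 3) (X Y Z : V) : η a (𝒮 X Y Z) = 0 := by
  rw [etaL_apply, metric_residual_skew, residual_xi, map_zero, LinearMap.zero_apply, neg_zero]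

theorem metric_residual_phi_right (a : Fin 3) (X Y Z W : V) :
    ⟪𝒮 X Y Z, φ a W⟫ = -⟪𝒮 X Y (φ a Z), W⟫ := by
  rw [residual_phi, metric_phi, neg_neg]

theorem metric_residual_phi_left (a : Fin 3) (X Y Z W : V) :
    ⟪𝒮 X (φ a Y) Z, W⟫ = -⟪𝒮 (φ a X) Y Z, W⟫ := by
  rw [metric_residual_pair, metric_residual_phi_right, metric_residual_pair (φ a X), residual_phi]

variable (F V) in
/-- The trace of a bilinear form with respect to the metric. -/
def frameTrace (b : V →ₗ[F] V →ₗ[F] F) : F := ∑ i, b (fr F V i) (fr F V i)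

theorem sum_metric_smul_fr (X : V) : ∑ i, ⟪X, fr F V i⟫ • fr F V i = X :=
  (ACM3.frame_span (F := F) X).symm

theorem sum_metric_mul_metric (X Y : V) : ∑ i, ⟪X, fr F V i⟫ * ⟪Y, fr F V i⟫ = ⟪X, Y⟫ := by
  conv_rhs => rw [← sum_metric_smul_fr (F := F) Y]
  simp only [map_sum, map_smul, smul_eq_mul, mul_comm]

theorem frameTrace_adjoint (b : V →ₗ[F] V →ₗ[F] F) {L M : V →ₗ[F] V}
    (h : ∀ X Y, ⟪L X, Y⟫ = ⟪X, M Y⟫) : frameTrace F V (b.comp L) = frameTrace F V (b.compl₂ M) := by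
  have e1 (i) : b (L (fr F V i)) (fr F V i)
      = ∑ j, ⟪L (fr F V i), fr F V j⟫ * b (fr F V j) (fr F V i) := by
    conv_lhs => rw [← sum_metric_smul_fr (F := F) (L (fr F V i))]
    simp
  have e2 (i) : b (fr F V i) (M (fr F V i))
      = ∑ j, ⟪L (fr F V j), fr F V i⟫ * b (fr F V i) (fr F V j) := by
    conv_lhs => rw [← sum_metric_smul_fr (F := F) (M (fr F V i))]
    simp [h, metric_comm F V (M _)]
  simp only [frameTrace, LinearMap.comp_apply, LinearMap.compl₂_apply, e1, e2]
  exact Finset.sum_comm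

theorem frameTrace_phi (a : Fin 3) (b : V →ₗ[F] V →ₗ[F] F) :
    frameTrace F V (b.comp (φ a)) = -frameTrace F V (b.compl₂ (φ a)) := by
  rw [frameTrace_adjoint b (M := -φ a) fun X Y => by
    rw [metric_phi, LinearMap.neg_apply, map_neg]]
  simp [frameTrace]

variable (F V) in
/-- The Ricci contraction of the residual curvature. -/
def residualRic (X Y : V) : F := frameTrace F V ((metric F V).comp (((residual F V).flip X).flip Y))

theorem residualRic_comm (X Y : V) : residualRic F V X Y = residualRic F V Y X := by
  simp only [residualRic, frameTrace, LinearMap.comp_apply, LinearMap.flip_apply]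
  refine Finset.sum_congr rfl fun i _ => ?_
  rw [metric_residual_pair, residual_skew, map_neg, LinearMap.neg_apply, metric_residual_skew,
    neg_neg]

theorem frameTrace_residual_phi (a : Fin 3) (X Y : V) :
    frameTrace F V ((metric F V).compl₁₂ (((residual F V).flip X).flip Y) (φ a))
      = -residualRic F V X (φ a Y) := by
  simp only [residualRic, frameTrace, LinearMap.comp_apply, LinearMap.flip_apply,
    LinearMap.compl₁₂_apply, metric_residual_phi_right, Finset.sum_neg_distrib]

theorem residualRic_phi (a : Fin 3) (X Y : V) :
    residualRic F V (φ a X) Y = -residualRic F V X (φ a Y) := by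
  rw [← frameTrace_residual_phi]
  have h := frameTrace_phi a ((metric F V).comp (((residual F V).flip X).flip Y))
  simp only [residualRic, frameTrace, LinearMap.comp_apply, LinearMap.flip_apply,
    LinearMap.compl₁₂_apply, LinearMap.compl₂_apply, metric_residual_phi_left,
    Finset.sum_neg_distrib] at h ⊢
  linear_combination -h

theorem sum_residual_phi (a : Fin 3) (X Y : V) :
    ∑ i, ⟪𝒮 X Y (fr F V i), φ a (fr F V i)⟫ = 2 * residualRic F V X (φ a Y) := by
  have h1 := frameTrace_residual_phi (F := F) a X Y
  have h2 := frameTrace_residual_phi (F := F) a Y X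
  rw [residualRic_comm, residualRic_phi] at h2
  have e (Z : V) : 𝒮 X Y Z = 𝒮 Z Y X - 𝒮 Z X Y := by
    linear_combination (norm := module) residual_bianchi (F := F) X Y Z
      - residual_skew (F := F) Y Z X
  simp only [frameTrace, LinearMap.flip_apply, LinearMap.compl₁₂_apply] at h1 h2
  simp only [e, map_sub, LinearMap.sub_apply, Finset.sum_sub_distrib, h1, h2]
  ring

theorem sum_residual_phi_zero (X Y : V) :
    ∑ i, ⟪𝒮 X Y (fr F V i), φ 0 (fr F V i)⟫ = 0 := by
  have hc : Cyclic 2 0 1 := by simp [Cyclic]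
  have h := frameTrace_phi 2 (((metric F V).comp (𝒮 X Y)).compl₂ (φ 0 ∘ₗ φ 2))
  have e (Z : V) : ⟪φ 2 (𝒮 X Y Z), φ 2 (φ 0 Z)⟫ = ⟪𝒮 X Y Z, φ 0 Z⟫ := by
    rw [metric_phi_phi, etaL_residual, zero_mul, sub_zero]
  have e1 (Z : V) : φ 0 (φ 2 Z) = -φ 2 (φ 0 Z) + η 0 Z • ξ 2 + η 2 Z • ξ 0 := by
    rw [hc.phi_phi, hc.phi_phi']
    module
  simp only [frameTrace, LinearMap.comp_apply, LinearMap.compl₂_apply, residual_phi, e1, e,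
    hc.eta_phi', hc.phi_xi', map_add, map_neg, map_smul, phi_sq, metric_xi_right,
    etaL_residual, eta_phi_self, neg_zero, smul_eq_mul, mul_zero, add_zero, Finset.sum_neg_distrib] at h
  apply eq_zero_of_two_mul
  linear_combination -h

theorem residualRic_eq_zero (X Y : V) : residualRic F V X Y = 0 := by
  have hphi (Y : V) : residualRic F V X (φ 0 Y) = 0 := by
    apply eq_zero_of_two_mul
    rw [← sum_residual_phi, sum_residual_phi_zero]
  have e : residualRic F V X (φ 0 (φ 0 Y)) = -residualRic F V X Y := by
    simp only [residualRic, frameTrace, LinearMap.comp_apply, LinearMap.flip_apply]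
    simp only [phi_sq, map_add, map_neg, map_smul, residual_xi, smul_zero, add_zero,
      LinearMap.neg_apply, Finset.sum_neg_distrib]
  rw [← neg_eq_zero, ← e, hphi]

variable (F V) in
/-- The trace of the endomorphism `A`. -/
def shapeTrace : F := ∑ i, ⟪𝒜 (fr F V i), fr F V i⟫

theorem Ric_eq (X Y : V) : Ric F V X Y = (shapeTrace F V - κ) * ⟪𝒜 X, Y⟫ := by
  have h := residualRic_eq_zero (F := F) X Y
  have h1 := sum_metric_mul_metric (F := F) (𝒜 Y) (𝒜 X)
  have h2 (i) : ⟪𝒜 (fr F V i), Y⟫ = ⟪𝒜 Y, fr F V i⟫ := by rw [metric_shape_comm, metric_comm]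
  simp only [residualRic, frameTrace, LinearMap.comp_apply, LinearMap.flip_apply, residual_apply,
    map_sub, map_smul, LinearMap.sub_apply, LinearMap.smul_apply, smul_eq_mul, h2,
    Finset.sum_sub_distrib, ← Finset.mul_sum, h1] at h
  rw [metric_comm F V (𝒜 Y), metric_shape_shape] at h
  simp only [Ric, gm_eq_metric, shapeTrace]
  linear_combination h

theorem dOne_eq (a : Fin 3) (X Y : V) : dOne F V (et F V a) X Y = ⟪φ a (𝒜 X), Y⟫ := by
  rw [← sub_eq_zero]
  apply eq_zero_of_two_mul
  rw [mul_sub, two_mul_dOne, cov_xi, cov_xi, metric_phi F V a (𝒜 Y), metric_shape_comm, shape_phi,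
    metric_comm F V Y]
  ring

theorem inE4m_of_shape_eq_zero {X : V} (hX : Horiz F V X) (h : 𝒜 X = 0) : InE4m F V X :=
  ⟨hX, fun a Y => by rw [dOne_eq, h, map_zero, map_zero, LinearMap.zero_apply]⟩

theorem InE4m.shape_eq_zero {X : V} (hX : InE4m F V X) : 𝒜 X = 0 := by
  have h : φ 0 (𝒜 X) = 0 := eq_of_metric_eq (F := F) fun Y => by
    rw [← dOne_eq, hX.2, map_zero, LinearMap.zero_apply]
  have h1 := phi_sq F V 0 (𝒜 X)
  rw [h, map_zero, eta_shape, ← et_eq_etaL, hX.1, mul_zero, zero_smul, add_zero] at h1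
  exact neg_eq_zero.mp h1.symm

theorem horiz_iff {X : V} : Horiz F V X ↔ ∀ a, η a X = 0 := by
  simp only [Horiz, et_eq_etaL]

theorem eta_xi (a b : Fin 3) : η a (ξ b) = if a = b then 1 else 0 := by
  have h1 : Cyclic 0 1 2 := by simp [Cyclic]
  have h2 : Cyclic 1 2 0 := by simp [Cyclic]
  have h3 : Cyclic 2 0 1 := by simp [Cyclic]
  fin_cases a <;> fin_cases b
  exacts [eta_xi_self F V 0, h1.eta_xi, h3.eta_xi', h1.eta_xi', eta_xi_self F V 1, h2.eta_xi,
    h3.eta_xi, h2.eta_xi', eta_xi_self F V 2]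

variable (F V) in
/-- The orthogonal projection to the vertical distribution. -/
def vertProj : V →ₗ[F] V := ∑ a : Fin 3, (η a).smulRight (ξ a)

theorem vertProj_apply (X : V) : vertProj F V X = ∑ a : Fin 3, η a X • ξ a := by
  simp [vertProj]

theorem horiz_sub_vertProj (X : V) : Horiz F V (X - vertProj F V X) := by
  rw [horiz_iff]
  intro a
  simp [vertProj_apply, eta_xi]

theorem shape_vertProj (X : V) : 𝒜 (vertProj F V X) = κ • vertProj F V X := by
  simp only [vertProj_apply, map_sum, map_smul, shape_xi, Finset.smul_sum]
  exact Finset.sum_congr rfl fun a _ => smul_comm _ _ _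

theorem vertProj_eq_zero {X : V} (hX : Horiz F V X) : vertProj F V X = 0 := by
  rw [horiz_iff] at hX
  simp [vertProj_apply, hX]

theorem vertProj_vertProj (X : V) : vertProj F V (vertProj F V X) = vertProj F V X := by
  have h := vertProj_eq_zero (horiz_sub_vertProj (F := F) X)
  rw [map_sub, sub_eq_zero] at h
  exact h.symm

theorem vertProj_shape (X : V) : vertProj F V (𝒜 X) = κ • vertProj F V X := by
  simp only [vertProj_apply, eta_shape, Finset.smul_sum, smul_smul]

theorem Horiz.shape {X : V} (hX : Horiz F V X) : Horiz F V (𝒜 X) := by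
  rw [horiz_iff] at *
  simp [eta_shape, hX]

theorem shape_eq_smul_of_horiz (h : ∀ X, Horiz F V X → 𝒜 X = κ • X) (X : V) : 𝒜 X = κ • X := by
  have h1 := h _ (horiz_sub_vertProj (F := F) X)
  rw [map_sub, shape_vertProj, smul_sub] at h1
  exact sub_left_injective h1

theorem shape_eq_zero (hc : κ = 0) (X : V) : 𝒜 X = 0 := by
  have hH (X : V) (hX : Horiz F V X) : 𝒜 X = κ • X := by
    have hm (W : V) (hW : Horiz F V W) : InE4m F V (𝒜 W) :=
      inE4m_of_shape_eq_zero hW.shape (by rw [shape_shape, hc, zero_smul])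
    obtain ⟨Y, Z, hY, hZ, rfl⟩ := ThreeQS.horiz_split (F := F) X hX
    have h1 : 𝒜 Y = 0 := eq_of_metric_eq (F := F) fun W => by
      have h2 : 𝒜 W = 𝒜 (W - vertProj F V W) := by
        rw [map_sub, shape_vertProj, hc, zero_smul, sub_zero]
      rw [metric_shape_comm, h2, ← gm_eq_metric, hY.2 _ (hm _ (horiz_sub_vertProj W)), map_zero,
        LinearMap.zero_apply]
    rw [map_add, h1, hZ.shape_eq_zero, hc, zero_smul, add_zero]
  rw [shape_eq_smul_of_horiz hH, hc, zero_smul]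

theorem sum_metric_vertProj :
    ∑ i, ⟪vertProj F V (fr F V i), fr F V i⟫ = 3 := by
  simp only [vertProj_apply, map_sum, LinearMap.sum_apply, map_smul, LinearMap.smul_apply,
    smul_eq_mul, metric_xi_left]
  rw [Finset.sum_comm]
  have h (a : Fin 3) : ∑ i, η a (fr F V i) * η a (fr F V i) = 1 := by
    have h1 := sum_metric_mul_metric (F := F) (ξ a) (ξ a)
    rw [metric_xi_left, eta_xi_self] at h1
    simpa only [metric_xi_left] using h1
  simp [h]

theorem Ric_xi (a : Fin 3) : Ric F V (ξ a) (ξ a) = (shapeTrace F V - κ) * κ := by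
  rw [Ric_eq, shape_xi, map_smul, LinearMap.smul_apply, metric_xi_left, eta_xi_self, smul_eq_mul,
    mul_one]

theorem trace_ne_neg_two {K : Type} [CommRing K] [Algebra ℝ K] [Nontrivial K] {m : ℕ}
    (M : Matrix (Fin m) (Fin m) K) (hM : M * M = M) : M.trace ≠ -2 := by
  intro h
  obtain ⟨I, hI⟩ := Ideal.exists_maximal K
  let _ := Ideal.Quotient.field I
  have : CharZero (K ⧸ I) :=
    charZero_of_injective_algebraMap (algebraMap ℝ (K ⧸ I)).injective
  set N : Matrix (Fin m) (Fin m) (K ⧸ I) := M.map (Ideal.Quotient.mk I) with hN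
  have hNN : IsIdempotentElem (Matrix.toLin' N) := by
    rw [IsIdempotentElem, Module.End.mul_eq_comp, ← Matrix.toLin'_mul, hN, ← Matrix.map_mul, hM]
  have h1 : N.trace = -2 := by
    rw [hN, ← AddMonoidHom.map_trace, h]
    simpa using map_ofNat (Ideal.Quotient.mk I) 2
  have h2 := (LinearMap.IsIdempotentElem.isProj_range _ hNN).trace
  rw [Matrix.trace_toLin'_eq, h1] at h2
  have h3 : ((Module.finrank (K ⧸ I) (LinearMap.range (Matrix.toLin' N)) + 2 : ℕ) : K ⧸ I) = 0 := by
    push_cast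
    rw [← h2]
    ring
  exact absurd (Nat.cast_eq_zero.mp h3) (by omega)

theorem shapeTrace_ne [Nontrivial F] (hc : cc F V ≠ 0) : shapeTrace F V ≠ κ := by
  intro h
  obtain ⟨u, hu⟩ : ∃ u : F, u * κ = 1 := ⟨algebraMap ℝ F (-(cc F V / 2))⁻¹, by
    rw [kap, ← map_mul, inv_mul_cancel₀ (by simpa using hc), map_one]⟩
  set Q : V →ₗ[F] V := u • 𝒜 - vertProj F V with hQ
  have hQQ (X : V) : Q (Q X) = Q X := by
    simp only [hQ, LinearMap.sub_apply, LinearMap.smul_apply, map_sub, map_smul, shape_shape,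
      shape_vertProj, vertProj_shape, vertProj_vertProj]
    linear_combination (norm := module) hu • (u • 𝒜 X) - (2 * hu) • vertProj F V X
  refine trace_ne_neg_two (Matrix.of fun i j => ⟪Q (fr F V i), fr F V j⟫) ?_ ?_
  · ext i j
    simp only [Matrix.mul_apply, Matrix.of_apply]
    rw [← hQQ (fr F V i)]
    conv_rhs => rw [← sum_metric_smul_fr (F := F) (Q (fr F V i))]
    simp [hQQ]
  · simp only [Matrix.trace, Matrix.diag, Matrix.of_apply, hQ, LinearMap.sub_apply,
      LinearMap.smul_apply, map_sub, map_smul, Finset.sum_sub_distrib, smul_eq_mul,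
      ← Finset.mul_sum, sum_metric_vertProj]
    rw [← shapeTrace, h, hu]
    norm_num

variable (F V) in
theorem threeCosymplectic_of_cc_eq_zero (hc : cc F V = 0) :
    ThreeCosymplectic F V ∧ ∀ X Y : V, Ric F V X Y = 0 := by
  have hA (X : V) : 𝒜 X = 0 := shape_eq_zero (by simp [kap, hc]) X
  refine ⟨fun a => ⟨(ThreeQS.qs a).1, fun X Y => ?_, (ThreeQS.qs a).2⟩, fun X Y => ?_⟩
  · rw [dOne_eq, hA, map_zero, map_zero, LinearMap.zero_apply]
  · rw [Ric_eq, hA, map_zero, LinearMap.zero_apply, mul_zero]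

theorem alphaSasakian_of_shape_eq (hc : cc F V ≠ 0) (h : ∀ X : V, 𝒜 X = κ • X) :
    (∃ a : ℝ, Is3AlphaSasakianWith F V a) ∧
      ∃ lam : ℝ, 0 < lam ∧ ∀ X Y : V, Ric F V X Y = algebraMap ℝ F lam * gm F V X Y := by
  refine ⟨⟨cc F V / 2, by simpa using hc, fun a => (ThreeQS.qs a).1, fun a X Y => ?_⟩,
    (-(cc F V / 2)) ^ 2 * (4 * dimn F V + 2), mul_pos (by rw [neg_sq]; positivity) (by positivity),
    fun X Y => ?_⟩
  · rw [dOne_eq, h, map_smul, map_smul, LinearMap.smul_apply, metric_phi, Phi, gm_eq_metric,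
      ph_eq_phiL, kap, map_neg, smul_eq_mul, neg_mul_neg]
  · have ht : shapeTrace F V = κ * (4 * dimn F V + 3) := by
      have he (i) : ⟪fr F V i, fr F V i⟫ = 1 :=
        (ACM3.frame_orth i i).trans (if_pos rfl)
      simp only [shapeTrace, h, map_smul, LinearMap.smul_apply, he, smul_eq_mul, mul_one,
        Finset.sum_const, Finset.card_univ, Fintype.card_fin, nsmul_eq_mul]
      push_cast
      ring
    rw [Ric_eq, ht, h, gm_eq_metric, map_smul, LinearMap.smul_apply, smul_eq_mul, kap]
    simp only [map_mul, map_pow, map_add, map_natCast, map_ofNat]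
    ring

theorem algebraMap_smul_eq_zero {r : ℝ} (hr : r ≠ 0) {X : V} (h : algebraMap ℝ F r • X = 0) :
    X = 0 := by
  rw [← one_smul F X, ← map_one (algebraMap ℝ F), ← inv_mul_cancel₀ hr, map_mul, mul_smul, h,
    smul_zero]

theorem not_einstein_of_shape_eq_zero (hc : cc F V ≠ 0)
    (h : ∀ X : V, Horiz F V X → 𝒜 X = 0) {X₀ : V} (hX₀ : Horiz F V X₀) (hne : X₀ ≠ 0) :
    ¬ Einstein F V := by
  rintro ⟨lam, hlam⟩
  have hA (X : V) : 𝒜 X = κ • vertProj F V X := by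
    rw [← shape_vertProj, ← sub_eq_zero, ← map_sub, h _ (horiz_sub_vertProj X)]
  have ht : shapeTrace F V = κ * 3 := by
    simp only [shapeTrace, hA, map_smul, LinearMap.smul_apply, smul_eq_mul, ← Finset.mul_sum,
      sum_metric_vertProj]
  have hl : algebraMap ℝ F lam = algebraMap ℝ F (cc F V ^ 2 / 2) := by
    have h1 := hlam (ξ 0) (ξ 0)
    rw [Ric_xi, ht, gm_eq_metric, metric_xi_left, eta_xi_self, mul_one] at h1
    have h2 : cc F V ^ 2 / 2 = 2 * (-(cc F V / 2)) ^ 2 := by ring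
    rw [← h1, h2, kap, map_mul, map_pow, map_ofNat]
    ring
  have h0 : algebraMap ℝ F lam • X₀ = 0 := eq_of_metric_eq (F := F) fun Y => by
    rw [map_smul, LinearMap.smul_apply, smul_eq_mul, ← gm_eq_metric, ← hlam, Ric_eq, h _ hX₀,
      map_zero, LinearMap.zero_apply, mul_zero]
  rw [hl] at h0
  exact hne (algebraMap_smul_eq_zero (F := F) (by simpa using hc) h0)

theorem shape_horiz_dichotomy (hE : EtaEinstein F V) (hc : cc F V ≠ 0) [Nontrivial F] :
    (∀ X : V, Horiz F V X → 𝒜 X = κ • X) ∨ ∀ X : V, Horiz F V X → 𝒜 X = 0 := by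
  obtain ⟨a, b, hab⟩ := hE
  have hH (X : V) (hX : Horiz F V X) :
      (shapeTrace F V - κ) • 𝒜 X = algebraMap ℝ F a • X := eq_of_metric_eq (F := F) fun Y => by
    have h := hab X Y
    simp only [Ric_eq, hX _, zero_mul, Finset.sum_const_zero, mul_zero, add_zero] at h
    rw [map_smul, map_smul, LinearMap.smul_apply, LinearMap.smul_apply, smul_eq_mul, smul_eq_mul]
    exact h
  by_cases ha : a = 0
  · right
    intro X hX
    have hx := hab (ξ 0) (ξ 0)
    simp only [ha, Ric_xi, et_eq_etaL, eta_xi, map_zero, zero_mul, zero_add, mul_ite, mul_one,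
      mul_zero, Finset.sum_ite_eq', Finset.mem_univ, if_true] at hx
    have hX' := hH X hX
    rw [ha, map_zero, zero_smul] at hX'
    refine algebraMap_smul_eq_zero (F := F) (r := b) ?_ ?_
    · rintro rfl
      refine shapeTrace_ne (F := F) (V := V) hc ?_
      rw [← sub_eq_zero, ← mul_one (shapeTrace F V - κ), ← map_one (algebraMap ℝ F),
        ← mul_inv_cancel₀ (show -(cc F V / 2) ≠ 0 by simpa using hc), map_mul, ← mul_assoc,
        ← kap, hx, map_zero, zero_mul]
    · rw [← hx, mul_comm, mul_smul, hX', smul_zero]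
  · left
    intro X hX
    have h1 := hH (𝒜 X) hX.shape
    rw [shape_shape, smul_comm, hH X hX, smul_comm] at h1
    rw [← sub_eq_zero]
    refine algebraMap_smul_eq_zero (F := F) ha ?_
    rw [smul_sub, h1, sub_self]


end threeQS

end algebraic

end QS3

namespace QS3

/-- No 3-quasi-Sasakian manifold is η-Einstein except:
(i) 3-α-Sasakian manifolds, which are Einstein with strictly positive scalar
curvature; (ii) 3-cosymplectic manifolds, which are Ricci-flat;
(iii) 3-quasi-Sasakian manifolds of rank 3, which are η-Einstein non-Einstein. -/
theorem etaEinstein_classification (F V : Type) [CommRing F] [Algebra ℝ F] [AddCommGroup V] [Module F V]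
    [SmoothSetting F V] [ACM3 F V] [ThreeQS F V] [LeviCivita F V]
    (h : EtaEinstein F V) :
    ((∃ a : ℝ, Is3AlphaSasakianWith F V a) ∧
      ∃ lam : ℝ, 0 < lam ∧
        ∀ X Y : V, Ric F V X Y = algebraMap ℝ F lam * gm F V X Y) ∨
    (ThreeCosymplectic F V ∧ ∀ X Y : V, Ric F V X Y = 0) ∨
    ((cc F V ≠ 0 ∧ ∀ X : V, Horiz F V X → InE4m F V X) ∧
      EtaEinstein F V ∧ ¬ Einstein F V) := by
  by_cases hc : cc F V = 0
  · exact Or.inr (Or.inl (threeCosymplectic_of_cc_eq_zero F V hc))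
  by_cases hH : ∃ X₀ : V, Horiz F V X₀ ∧ X₀ ≠ 0
  · obtain ⟨X₀, hX₀, hne⟩ := hH
    have : Nontrivial F := by
      by_contra hF
      have := not_nontrivial_iff_subsingleton.mp hF
      exact hne ((Module.subsingleton F V).elim X₀ 0)
    rcases shape_horiz_dichotomy h hc with h1 | h1
    · exact Or.inl (alphaSasakian_of_shape_eq hc (shape_eq_smul_of_horiz h1))
    · exact Or.inr (Or.inr ⟨⟨hc, fun X hX => inE4m_of_shape_eq_zero hX (h1 X hX)⟩, h,
        not_einstein_of_shape_eq_zero hc h1 hX₀ hne⟩)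
  · push Not at hH
    refine Or.inl (alphaSasakian_of_shape_eq hc (shape_eq_smul_of_horiz fun X hX => ?_))
    rw [hH X hX, map_zero, smul_zero]

end QS3
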